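/- arXiv:1308.0531 — 3 statements merged into one kernel-verified Lean document; each statement's English description precedes it below -/
import Mathlib

section
/- Tail property of the time periodic strictly positive solution (nonlocal dispersal case). Assume f satisfies (H0) and (H1) holds with limit nonlinearity f₀. Let u* be a time periodic strictly positive solution of (E_f), and let u₀* be a solution of (E_{f₀}) on ℝ satisfying u₀*(t+T,x) = u₀*(t,x) = u₀*(t, x + pᵢeᵢ) for all t, x and i = 1,…,N, with u₀*(t,x) > 0 for all (t,x). Then u*(t,x) − u₀*(t,x) → 0 as ‖x‖ → ∞ uniformly in t; that is, for every ε > 0 there exists R > 0 such that |u*(t,x) − u₀*(t,x)| < ε whenever t ∈ ℝ and ‖x‖ ≥ R. -/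
open MeasureTheory Set Filter RealInnerProductSpace

noncomputable section

abbrev Euc (N : ℕ) := EuclideanSpace ℝ (Fin N)

/-- Membership in `X`: bounded and uniformly continuous real functions on `ℝ^N`. -/
def MemX {N : ℕ} (u : Euc N → ℝ) : Prop :=
  UniformContinuous u ∧ ∃ C, ∀ x, |u x| ≤ C

/-- Hypotheses on the convolution kernel `κ`. -/
def KernelHyp {N : ℕ} (κ : Euc N → ℝ) : Prop :=
  Continuous κ ∧ (∀ z, 0 ≤ κ z) ∧ HasCompactSupport κ ∧ 0 < κ 0 ∧ (∫ z, κ z) = 1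

/-- Hypothesis (H0) on the nonlinearity `f`. -/
def SatH0 {N : ℕ} (T M₀ : ℝ) (f : ℝ → Euc N → ℝ → ℝ) : Prop :=
  (∀ t x u, f (t + T) x u = f t x u) ∧
  (∀ x : Euc N, ContDiff ℝ 1 (fun p : ℝ × ℝ => f p.1 x p.2)) ∧
  (∀ R : ℝ, 0 < R →
    (∃ C, ∀ t x u, |u| ≤ R →
      |f t x u| + |deriv (fun s => f s x u) t| + |deriv (fun v => f t x v) u| ≤ C) ∧
    UniformContinuousOn (fun p : ℝ × Euc N × ℝ => f p.1 p.2.1 p.2.2)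
      {p : ℝ × Euc N × ℝ | |p.2.2| ≤ R} ∧
    UniformContinuousOn (fun p : ℝ × Euc N × ℝ => deriv (fun s => f s p.2.1 p.2.2) p.1)
      {p : ℝ × Euc N × ℝ | |p.2.2| ≤ R} ∧
    UniformContinuousOn (fun p : ℝ × Euc N × ℝ => deriv (fun v => f p.1 p.2.1 v) p.2.2)
      {p : ℝ × Euc N × ℝ | |p.2.2| ≤ R}) ∧
  (∀ t x u, M₀ ≤ u → f t x u < 0) ∧
  (∀ a b : ℝ, 0 ≤ a → a ≤ b → ∃ c < (0:ℝ), ∀ t x u, a ≤ u → u ≤ b →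
    deriv (fun v => f t x v) u ≤ c)

/-- Right-hand side of the nonlocal dispersal KPP equation (E_g). -/
def RHS {N : ℕ} (κ : Euc N → ℝ) (g : ℝ → Euc N → ℝ → ℝ)
    (u : ℝ → Euc N → ℝ) (t : ℝ) (x : Euc N) : ℝ :=
  (∫ y, κ (y - x) * u t y) - u t x + u t x * g t x (u t x)

/-- A solution of (E_g) on the interval `I`. -/
def IsSol {N : ℕ} (κ : Euc N → ℝ) (g : ℝ → Euc N → ℝ → ℝ)
    (u : ℝ → Euc N → ℝ) (I : Set ℝ) : Prop :=
  ContinuousOn (fun p : ℝ × Euc N => u p.1 p.2) (I ×ˢ univ) ∧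
  (∀ t ∈ I, MemX (u t)) ∧
  (∀ J : Set ℝ, J ⊆ I → IsCompact J → ∃ C, ∀ t ∈ J, ∀ x, |u t x| ≤ C) ∧
  (∀ x : Euc N, ∀ t ∈ interior I, HasDerivAt (fun s => u s x) (RHS κ g u t x) t)

/-- A time periodic strictly positive solution of (E_g). -/
def PeriodicPosSol {N : ℕ} (κ : Euc N → ℝ) (g : ℝ → Euc N → ℝ → ℝ) (T : ℝ)
    (u : ℝ → Euc N → ℝ) : Prop :=
  IsSol κ g u univ ∧ (∀ t x, u (t + T) x = u t x) ∧ ∃ δ > 0, ∀ t x, δ ≤ u t x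

/-- The part metric between two strictly positive bounded functions. -/
def PartMetric {N : ℕ} (u v : Euc N → ℝ) : ℝ :=
  sInf (Real.log '' {α : ℝ | 1 ≤ α ∧ ∀ x, u x / α ≤ v x ∧ v x ≤ α * u x})

/-- Hypothesis (H1): `f` is asymptotically (in space) equal to the time and space
periodic nonlinearity `f₀`. -/
def SatH1 {N : ℕ} (T M₀ : ℝ) (p : Fin N → ℝ) (f f₀ : ℝ → Euc N → ℝ → ℝ) : Prop :=
  SatH0 T M₀ f₀ ∧ (∀ i, 0 < p i) ∧
  (∀ i t x u, f₀ t (x + p i • EuclideanSpace.single i (1:ℝ)) u = f₀ t x u) ∧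
  (∀ R : ℝ, 0 < R → ∀ ε : ℝ, 0 < ε → ∃ ρ : ℝ, ∀ t x u, ρ ≤ ‖x‖ → |u| ≤ R →
    |f t x u - f₀ t x u| ≤ ε)

/-- A time and space periodic positive solution of (E_g) (period `T` in time and
periods `pᵢ` in the spatial coordinate directions). -/
def PeriodicMediaSol {N : ℕ} (κ : Euc N → ℝ) (g : ℝ → Euc N → ℝ → ℝ) (T : ℝ)
    (p : Fin N → ℝ) (u : ℝ → Euc N → ℝ) : Prop :=
  IsSol κ g u univ ∧ (∀ t x, u (t + T) x = u t x) ∧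
  (∀ i t x, u t (x + p i • EuclideanSpace.single i (1:ℝ)) = u t x) ∧
  (∀ t x, 0 < u t x)

/-- The class `X⁺(ξ)` of front-like nonnegative initial data in the direction `ξ`. -/
def XplusXi {N : ℕ} (ξ : Euc N) (u : Euc N → ℝ) : Prop :=
  MemX u ∧ (∀ x, 0 ≤ u x) ∧
  (∃ m > 0, ∃ r : ℝ, ∀ x, ⟪x, ξ⟫ ≤ r → m ≤ u x) ∧
  (∃ r₀ : ℝ, ∀ x, r₀ ≤ ⟪x, ξ⟫ → u x = 0)


lemma aux_integrable {N : ℕ} {κ : Euc N → ℝ} (hκ : KernelHyp κ) {w : Euc N → ℝ}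
    (hw : Continuous w) (x : Euc N) : Integrable (fun y => κ (y - x) * w y) := by
  obtain ⟨h1, h2, h3, h4, h5⟩ := hκ
  apply Continuous.integrable_of_hasCompactSupport
  · fun_prop
  · have := h3.comp_homeomorph (Homeomorph.subRight x)
    exact HasCompactSupport.mul_right (f' := w) this

lemma aux_int_one {N : ℕ} {κ : Euc N → ℝ} (hκ : KernelHyp κ) (x : Euc N) :
    (∫ y, κ (y - x)) = 1 := by
  rw [integral_sub_right_eq_self (fun y => κ y) x]
  exact hκ.2.2.2.2

lemma aux_max {T : ℝ} (hT : 0 < T) (φ : ℝ → ℝ) (hc : Continuous φ)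
    (hp : ∀ t, φ (t + T) = φ t) : ∃ t, ∀ s, φ s ≤ φ t := by
  obtain ⟨t, _, h⟩ := (isCompact_Icc (a := (0:ℝ)) (b := T)).exists_isMaxOn
    ⟨0, by simp [hT.le]⟩ hc.continuousOn
  refine ⟨t, fun s => ?_⟩
  obtain ⟨y, hy, e⟩ := Function.Periodic.exists_mem_Ico₀ (f := φ) hp hT s
  rw [e]
  exact h ⟨hy.1, hy.2.le⟩

lemma aux_key {N : ℕ} {κ : Euc N → ℝ} (hκ : KernelHyp κ) {T : ℝ} (hT : 0 < T)
    {g h : ℝ → Euc N → ℝ → ℝ} {u v : ℝ → Euc N → ℝ}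
    (hu : IsSol κ g u univ) (hv : IsSol κ h v univ)
    (hup : ∀ t x, u (t + T) x = u t x) (hvp : ∀ t x, v (t + T) x = v t x)
    {δ M c : ℝ} (hδ : 0 < δ) (hc : 0 < c)
    (hul : ∀ t x, δ ≤ u t x) (hvl : ∀ t x, δ ≤ v t x)
    (huM : ∀ t x, u t x ≤ M) (hvM : ∀ t x, v t x ≤ M)
    (hcmp : ∀ ε > 0, ∃ ρ : ℝ, ∀ t x, ρ ≤ ‖x‖ → v t x ≤ u t x →
      g t x (u t x) - h t x (v t x) ≤ ε - c * (u t x - v t x)) :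
    ∀ η > 0, ∃ R : ℝ, ∀ t x, R ≤ ‖x‖ → u t x ≤ (1 + η) * v t x := by
  have hv0 : ∀ t x, 0 < v t x := fun t x => hδ.trans_le (hvl t x)
  have hu0 : ∀ t x, 0 < u t x := fun t x => hδ.trans_le (hul t x)
  have hM : 0 < M := (hu0 0 0).trans_le (huM 0 0)
  obtain ⟨r, hr⟩ : ∃ r : ℝ, ∀ z, κ z ≠ 0 → ‖z‖ ≤ r := by
    obtain ⟨r, hr⟩ := hκ.2.2.1.isCompact.isBounded.exists_norm_le
    exact ⟨r, fun z hz => hr z (subset_tsupport _ hz)⟩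
  -- local estimate
  have main : ∀ A R : ℝ, (∀ t x, R ≤ ‖x‖ → u t x ≤ A * v t x) → ∀ ε ρ : ℝ,
      (∀ t x, ρ ≤ ‖x‖ → v t x ≤ u t x →
        g t x (u t x) - h t x (v t x) ≤ ε - c * (u t x - v t x)) →
      ∀ x, max R ρ + |r| ≤ ‖x‖ → ∃ m, (∀ t, u t x / v t x ≤ m) ∧
        (1 ≤ m → 0 ≤ (A - m) * (M / δ) + m * (ε - c * δ * (m - 1))) := by
    intro A R hA ε ρ hρ x hx
    have hxR : R + |r| ≤ ‖x‖ := by linarith [le_max_left R ρ]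
    have hxρ : ρ ≤ ‖x‖ := by linarith [le_max_right R ρ, abs_nonneg r]
    have du := fun t => hu.2.2.2 x t (by simp)
    have dv := fun t => hv.2.2.2 x t (by simp)
    have dφ := fun t => (du t).fun_div (dv t) (hv0 t x).ne'
    obtain ⟨t, ht⟩ := aux_max hT (fun t => u t x / v t x)
      (continuous_iff_continuousAt.2 fun t => (dφ t).continuousAt)
      (fun t => by simp only [hup, hvp])
    refine ⟨u t x / v t x, ht, fun hm => ?_⟩
    have hz := IsLocalMax.hasDerivAt_eq_zero (Filter.Eventually.of_forall ht) (dφ t)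
    have huc : Continuous (u t) := (hu.2.1 t trivial).1.continuous
    have hvc : Continuous (v t) := (hv.2.1 t trivial).1.continuous
    have hKu : (∫ y, κ (y - x) * u t y) ≤ A * ∫ y, κ (y - x) * v t y := by
      rw [← integral_const_mul]
      apply integral_mono (aux_integrable hκ huc x)
        ((aux_integrable hκ hvc x).const_mul A)
      intro y
      show κ (y - x) * u t y ≤ A * (κ (y - x) * v t y)
      by_cases h0 : κ (y - x) = 0
      · simp [h0]
      · have h1 := hr _ h0
        have h2 : ‖x‖ - ‖y‖ ≤ ‖y - x‖ := by
          rw [norm_sub_rev]; exact norm_sub_norm_le x y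
        have h3 := hA t y (by linarith [le_abs_self r])
        have := mul_le_mul_of_nonneg_left h3 (hκ.2.1 (y - x))
        linarith
    have hKv : (∫ y, κ (y - x) * v t y) ≤ M := by
      have : (∫ y, κ (y - x) * v t y) ≤ ∫ y, κ (y - x) * M := by
        apply integral_mono (aux_integrable hκ hvc x)
          (aux_integrable hκ continuous_const x)
        intro y
        exact mul_le_mul_of_nonneg_left (hvM t y) (hκ.2.1 _)
      rwa [integral_mul_const, aux_int_one hκ, one_mul] at this
    have hKv0 : 0 ≤ (∫ y, κ (y - x) * v t y) :=
      integral_nonneg fun y => mul_nonneg (hκ.2.1 _) (hv0 t y).le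
    have hAx := hA t x (by linarith [abs_nonneg r])
    have hf := hρ t x hxρ ((one_le_div (hv0 t x)).1 hm)
    rw [div_eq_zero_iff] at hz
    have hz := hz.resolve_right (by have := hv0 t x; positivity)
    simp only [RHS] at hz
    have hvp := hv0 t x
    have hup := hu0 t x
    have hvd := hvl t x
    generalize (∫ y, κ (y - x) * u t y) = Ku at *
    generalize (∫ y, κ (y - x) * v t y) = Kv at *
    generalize g t x (u t x) = G at *
    generalize h t x (v t x) = H at *
    obtain ⟨m, hm'⟩ : ∃ m, m = u t x / v t x := ⟨_, rfl⟩
    rw [← hm'] at hm ⊢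
    have hum : u t x = m * v t x := by rw [hm']; field_simp
    rw [hum] at hz hf hAx
    generalize v t x = V at *
    have hAm : m ≤ A := le_of_mul_le_mul_right hAx hvp
    have e1 : 0 = (Ku - m * Kv) + m * V * (G - H) := by
      have : V * ((Ku - m * Kv) + m * V * (G - H)) = 0 := by linear_combination hz
      rcases mul_eq_zero.1 this with h | h
      · exact absurd h hvp.ne'
      · exact h.symm
    have e2 : Ku - m * Kv ≤ (A - m) * M := by nlinarith
    have e3 : G - H ≤ ε - c * δ * (m - 1) := by
      have : c * δ * (m - 1) ≤ c * V * (m - 1) := by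
        have : 0 ≤ m - 1 := by linarith
        gcongr
      nlinarith
    have e4 : 0 ≤ (A - m) * M + V * (m * (ε - c * δ * (m - 1))) := by
      have : m * V * (G - H) ≤ m * V * (ε - c * δ * (m - 1)) := by gcongr
      nlinarith
    have e5 : 0 ≤ (A - m) * (M / V) + (m * (ε - c * δ * (m - 1))) := by
      have : (A - m) * (M / V) + (m * (ε - c * δ * (m - 1))) =
        ((A - m) * M + V * (m * (ε - c * δ * (m - 1)))) / V := by field_simp
      rw [this]; positivity
    have e6 : (A - m) * (M / V) ≤ (A - m) * (M / δ) := by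
      have : 0 ≤ A - m := by linarith
      gcongr
    linarith
  -- infimum argument
  set S : Set ℝ := {A | 1 ≤ A ∧ ∃ R : ℝ, ∀ t x, R ≤ ‖x‖ → u t x ≤ A * v t x} with hS
  have hSne : S.Nonempty := by
    refine ⟨max 1 (M / δ), le_max_left _ _, 0, fun t x _ => ?_⟩
    calc u t x ≤ M := huM t x
      _ = M / δ * δ := by field_simp
      _ ≤ max 1 (M / δ) * v t x :=
        mul_le_mul (le_max_right _ _) (hvl t x) hδ.le (by positivity)
  have hSb : BddBelow S := ⟨1, fun A hA => hA.1⟩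
  have hle : sInf S ≤ 1 := by
    by_contra! hlt
    set a := sInf S with ha
    set d := a - 1 with hd
    have hd0 : 0 < d := by linarith
    set C := M / δ with hC
    have hC0 : 0 < C := by positivity
    obtain ⟨σ, hσ0, hσ1, hσ2⟩ : ∃ σ > 0, σ ≤ d / 2 ∧ 2 * σ * C < c * δ * d / 4 := by
      refine ⟨min (d / 2) (c * δ * d / (16 * C)), by positivity, min_le_left _ _, ?_⟩
      have : min (d / 2) (c * δ * d / (16 * C)) * C ≤ c * δ * d / (16 * C) * C := by
        gcongr; exact min_le_right _ _
      have e : c * δ * d / (16 * C) * C = c * δ * d / 16 := by field_simp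
      have : 0 < c * δ * d := by positivity
      linarith
    obtain ⟨A, ⟨hA1, R, hR⟩, hA2⟩ := exists_lt_of_csInf_lt hSne (show sInf S < a + σ by linarith)
    obtain ⟨ρ, hρ⟩ := hcmp (c * δ * d / 4) (by positivity)
    have : a - σ ∈ S := by
      refine ⟨by linarith, max R ρ + |r|, fun t x hx => ?_⟩
      obtain ⟨m, hm, hm2⟩ := main A R hR _ ρ hρ x hx
      rw [← div_le_iff₀ (hv0 t x)]
      refine (hm t).trans ?_
      by_contra! hmm
      have h1m : 1 ≤ m := by linarith
      have := hm2 h1m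
      have i1 : (A - m) * C ≤ 2 * σ * C := by
        gcongr; linarith
      have i2 : c * δ * (d / 2) ≤ c * δ * (m - 1) := by
        gcongr; linarith
      have hp : 0 < c * δ * d := by positivity
      have i3 : m * (c * δ * d / 4 - c * δ * (m - 1)) ≤ -(c * δ * d / 4) := by
        nlinarith
      linarith
    have := csInf_le hSb this
    linarith
  intro η hη
  obtain ⟨A, ⟨hA1, R, hR⟩, hA2⟩ := exists_lt_of_csInf_lt hSne (show sInf S < 1 + η by linarith)
  exact ⟨R, fun t x hx => (hR t x hx).trans
    (mul_le_mul_of_nonneg_right hA2.le (hv0 t x).le)⟩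

lemma aux_bdd {N : ℕ} {κ : Euc N → ℝ} {T : ℝ} (hT : 0 < T)
    {g : ℝ → Euc N → ℝ → ℝ} {u : ℝ → Euc N → ℝ}
    (hu : IsSol κ g u univ) (hup : ∀ t x, u (t + T) x = u t x) :
    ∃ M, ∀ t x, u t x ≤ M := by
  obtain ⟨C, hC⟩ := hu.2.2.1 (Icc 0 T) (subset_univ _) isCompact_Icc
  refine ⟨C, fun t x => ?_⟩
  obtain ⟨y, hy, e⟩ := Function.Periodic.exists_mem_Ico₀ (f := fun t => u t x)
    (fun t => hup t x) hT t
  have e : u t x = u y x := e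
  rw [e]
  exact (le_abs_self _).trans (hC y ⟨hy.1, hy.2.le⟩ x)

lemma aux_pos {N : ℕ} {T : ℝ} (hT : 0 < T) {p : Fin N → ℝ} (hp : ∀ i, 0 < p i)
    {v : ℝ → Euc N → ℝ} (hc : Continuous (fun q : ℝ × Euc N => v q.1 q.2))
    (hvp : ∀ t x, v (t + T) x = v t x)
    (hvx : ∀ i t x, v t (x + p i • EuclideanSpace.single i (1:ℝ)) = v t x)
    (h0 : ∀ t x, 0 < v t x) : ∃ δ > 0, ∀ t x, δ ≤ v t x := by
  obtain ⟨q, hq, hmin⟩ := ((isCompact_Icc (a := (0:ℝ)) (b := T)).prod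
    (isCompact_closedBall (0 : Euc N) (∑ i, p i))).exists_isMinOn
    ⟨(0, 0), by simp [hT.le, Finset.sum_nonneg (fun i _ => (hp i).le)]⟩ hc.continuousOn
  refine ⟨v q.1 q.2, h0 _ _, fun t x => ?_⟩
  obtain ⟨s, hs, e⟩ := Function.Periodic.exists_mem_Ico₀ (f := fun t => v t x)
    (fun t => hvp t x) hT t
  have e : v t x = v s x := e
  rw [e]
  let y : Euc N := ∑ i, (Int.fract (x i / p i) * p i) • EuclideanSpace.single i (1:ℝ)
  have hshift : ∀ (n : Fin N → ℤ) (F : Finset (Fin N)) (z : Euc N),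
      v s (z + ∑ i ∈ F, n i • (p i • EuclideanSpace.single i (1:ℝ) : Euc N)) = v s z := by
    intro n F
    induction F using Finset.induction_on with
    | empty => simp
    | insert i F hi ih =>
      intro z
      rw [Finset.sum_insert hi, ← add_assoc, ih]
      exact (Function.Periodic.zsmul (f := v s) (hvx i s) (n i)) z
  have hxy : x = y + ∑ i, ⌊x i / p i⌋ • (p i • EuclideanSpace.single i (1:ℝ) : Euc N) := by
    rw [← Finset.sum_add_distrib]
    ext j
    have hpj := (hp j).ne'
    have : Int.fract (x j / p j) * p j + ⌊x j / p j⌋ * p j = x j := by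
      rw [← add_mul, Int.fract_add_floor]; field_simp
    simp [Pi.single_apply, Finset.sum_add_distrib]
    linarith
  rw [hxy, hshift]
  refine hmin (show (s, y) ∈ _ from ⟨⟨hs.1, hs.2.le⟩, ?_⟩)
  rw [mem_closedBall_zero_iff]
  change ‖∑ i, (Int.fract (x i / p i) * p i) • (EuclideanSpace.single i (1:ℝ) : Euc N)‖ ≤ _
  refine (norm_sum_le _ _).trans (Finset.sum_le_sum fun i _ => ?_)
  rw [norm_smul, EuclideanSpace.norm_single, norm_one, mul_one, Real.norm_of_nonneg]
  · have := (Int.fract_lt_one (x i / p i)).le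
    nlinarith [hp i]
  · exact mul_nonneg (Int.fract_nonneg _) (hp i).le

lemma aux_mono {N : ℕ} {T M₀ : ℝ} {f : ℝ → Euc N → ℝ → ℝ} (hf : SatH0 T M₀ f) {δ M : ℝ}
    (hδ : 0 < δ) (hM : δ ≤ M) : ∃ c > 0, ∀ t x a b, δ ≤ a → a ≤ b → b ≤ M →
      f t x b - f t x a ≤ - c * (b - a) := by
  obtain ⟨c, hc, h⟩ := hf.2.2.2.2 δ M hδ.le hM
  refine ⟨-c, by linarith, fun t x a b ha hab hb => ?_⟩
  have hd : Differentiable ℝ (fun v => f t x v) := by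
    have := (hf.2.1 x).differentiable one_ne_zero
    exact this.comp (f := fun v : ℝ => (t, v)) (by fun_prop)
  rw [neg_neg]
  refine (convex_Icc a b).image_sub_le_mul_sub_of_deriv_le (f := fun v => f t x v)
    hd.continuous.continuousOn hd.differentiableOn ?_ a ⟨le_rfl, hab⟩ b ⟨hab, le_rfl⟩ hab
  intro w hw
  have hw := interior_subset hw
  exact h t x w (ha.trans hw.1) (hw.2.trans hb)

/-- tail property of the time periodic strictly positive solution. -/
theorem stmt12 {N : ℕ} (hN : 1 ≤ N) (T M₀ : ℝ) (hT : 0 < T) (hM₀ : 0 < M₀)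
    (κ : Euc N → ℝ) (hκ : KernelHyp κ)
    (f : ℝ → Euc N → ℝ → ℝ) (hf : SatH0 T M₀ f)
    (f₀ : ℝ → Euc N → ℝ → ℝ) (p : Fin N → ℝ) (h1 : SatH1 T M₀ p f f₀)
    (ustar : ℝ → Euc N → ℝ) (hstar : PeriodicPosSol κ f T ustar)
    (u₀star : ℝ → Euc N → ℝ) (h0star : PeriodicMediaSol κ f₀ T p u₀star) :
    ∀ ε > (0:ℝ), ∃ R > (0:ℝ), ∀ t : ℝ, ∀ x : Euc N,
      R ≤ ‖x‖ → |ustar t x - u₀star t x| < ε := by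
  obtain ⟨hu, hup, δ₁, hδ₁, hul⟩ := hstar
  obtain ⟨hv, hvp, hvx, hv0⟩ := h0star
  obtain ⟨hf0, hp, -, hlim⟩ := h1
  obtain ⟨δ₂, hδ₂, hvl⟩ := aux_pos hT hp
    (continuousOn_univ.1 (by simpa using hv.1)) hvp hvx hv0
  obtain ⟨M₁, hM₁⟩ := aux_bdd hT hu hup
  obtain ⟨M₂, hM₂⟩ := aux_bdd hT hv hvp
  obtain ⟨δ, hδ, hul, hvl⟩ : ∃ δ > 0, (∀ t x, δ ≤ ustar t x) ∧ (∀ t x, δ ≤ u₀star t x) :=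
    ⟨min δ₁ δ₂, lt_min hδ₁ hδ₂, fun t x => (min_le_left _ _).trans (hul t x),
      fun t x => (min_le_right _ _).trans (hvl t x)⟩
  obtain ⟨M, huM, hvM⟩ : ∃ M, (∀ t x, ustar t x ≤ M) ∧ (∀ t x, u₀star t x ≤ M) :=
    ⟨max M₁ M₂, fun t x => (hM₁ t x).trans (le_max_left _ _),
      fun t x => (hM₂ t x).trans (le_max_right _ _)⟩
  have hδM : δ ≤ M := (hul 0 0).trans (huM 0 0)
  have hM : 0 < M := hδ.trans_le hδM
  obtain ⟨c, hc, hmono⟩ := aux_mono hf0 hδ hδM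
  have hlim' : ∀ ε > 0, ∃ ρ : ℝ, ∀ t x, ρ ≤ ‖x‖ →
      |f t x (ustar t x) - f₀ t x (ustar t x)| ≤ ε := by
    intro ε hε
    obtain ⟨ρ, hρ⟩ := hlim M hM ε hε
    refine ⟨ρ, fun t x hx => hρ t x _ hx ?_⟩
    rw [abs_of_pos (hδ.trans_le (hul t x))]
    exact huM t x
  have k1 := aux_key hκ hT hu hv hup hvp hδ hc hul hvl huM hvM (by
    intro ε hε
    obtain ⟨ρ, hρ⟩ := hlim' ε hε
    refine ⟨ρ, fun t x hx hle => ?_⟩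
    have h1 := (abs_le.1 (hρ t x hx)).2
    have h2 := hmono t x _ _ (hvl t x) hle (huM t x)
    linarith)
  have k2 := aux_key hκ hT hv hu hvp hup hδ hc hvl hul hvM huM (by
    intro ε hε
    obtain ⟨ρ, hρ⟩ := hlim' ε hε
    refine ⟨ρ, fun t x hx hle => ?_⟩
    have h1 := (abs_le.1 (hρ t x hx)).1
    have h2 := hmono t x _ _ (hul t x) hle (hvM t x)
    linarith)
  intro ε hε
  obtain ⟨R₁, hR₁⟩ := k1 (ε / (2 * M)) (by positivity)
  obtain ⟨R₂, hR₂⟩ := k2 (ε / (2 * M)) (by positivity)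
  refine ⟨max 1 (max R₁ R₂), by positivity, fun t x hx => ?_⟩
  have a1 := hR₁ t x (((le_max_left _ _).trans (le_max_right _ _)).trans hx)
  have a2 := hR₂ t x (((le_max_right _ _).trans (le_max_right _ _)).trans hx)
  have e : ε / (2 * M) * M = ε / 2 := by field_simp
  have b1 : ε / (2 * M) * u₀star t x ≤ ε / (2 * M) * M := by gcongr; exact hvM t x
  have b2 : ε / (2 * M) * ustar t x ≤ ε / (2 * M) * M := by gcongr; exact huM t x
  rw [abs_lt]
  constructor <;> linarith

end
end

section
/- Exponential super-solution bound and upper spreading estimate (nonlocal dispersal case; extraction of the proof of Theorem 2.2, upper bound). Assume f satisfies (H0). Let ξ ∈ ℝ^N with ‖ξ‖ = 1, μ > 0, λ ∈ ℝ, and let a : ℝ × ℝ^N → ℝ and φ : ℝ × ℝ^N → ℝ be continuous functions satisfying a(t+T,x) = a(t,x) = a(t, x + pᵢeᵢ) and φ(t+T,x) = φ(t,x) = φ(t, x + pᵢeᵢ) for all t, x and i = 1,…,N, with inf φ > 0, φ differentiable in t, and ∂_t φ(t,x) = ∫_{ℝ^N} e^{−μ (y−x)·ξ} κ(y−x) φ(t,y)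 dy − φ(t,x) + a(t,x) φ(t,x) − λ φ(t,x) for all (t,x). Assume also f(t,x,u) ≤ a(t,x) for all t ∈ ℝ, x ∈ ℝ^N, u ≥ 0. Let M > 0 and let u be a solution of (E_f) on [0,∞) with 0 ≤ u(0,x) ≤ M e^{−μ x·ξ} φ(0,x) for all x, and u(t,x) ≥ 0 for all t, x. Then u(t,x) ≤ M e^{−μ(x·ξ − (λ/μ) t)} φ(t,x) for all t ≥ 0 and x ∈ ℝ^N; consequently, for every c > λ/μ, sup{ u(t,x) : x·ξ ≥ ct } → 0 as t → ∞. -/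
open MeasureTheory Set Filter RealInnerProductSpace

noncomputable section

lemma per_bound {N : ℕ} (T : ℝ) (hT : 0 < T) (p : Fin N → ℝ) (hp : ∀ i, 0 < p i)
    (φ : ℝ → Euc N → ℝ)
    (hφc : Continuous (fun q : ℝ × Euc N => φ q.1 q.2))
    (hφper : ∀ t x, φ (t + T) x = φ t x)
    (hφspace : ∀ i t x, φ t (x + p i • EuclideanSpace.single i (1:ℝ)) = φ t x) :
    ∃ B, 0 ≤ B ∧ ∀ t x, φ t x ≤ B := by
  let S : AddSubgroup (Euc N) :=
    { carrier := {z | ∀ t x, φ t (x + z) = φ t x}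
      zero_mem' := by intro t x; simp
      add_mem' := by
        intro z w hz hw t x
        rw [← add_assoc, hw, hz]
      neg_mem' := by
        intro z hz t x
        have := hz t (x + -z)
        simpa using this.symm }
  have hS : ∀ i, p i • EuclideanSpace.single i (1:ℝ) ∈ S := fun i t x => hφspace i t x
  have hK : IsCompact (Icc (0:ℝ) T ×ˢ Metric.closedBall (0 : Euc N) (∑ i, p i)) :=
    isCompact_Icc.prod (isCompact_closedBall _ _)
  obtain ⟨B, hB⟩ := hK.bddAbove_image hφc.continuousOn
  refine ⟨max B 0, le_max_right _ _, fun t x => le_trans ?_ (le_max_left _ _)⟩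
  have hper : Function.Periodic (fun t => φ t) T := fun t => funext fun x => hφper t x
  obtain ⟨s, hs, hst⟩ := hper.exists_mem_Ico₀ hT t
  have hst' : φ t = φ s := hst
  rw [hst']
  let z : Euc N := ∑ i, (-⌊x i / p i⌋) • (p i • EuclideanSpace.single i (1:ℝ))
  have hz : z ∈ S := S.sum_mem fun i _ => S.zsmul_mem (hS i) _
  rw [← hz s x]
  apply hB
  refine ⟨(s, x + z), ⟨⟨hs.1, hs.2.le⟩, ?_⟩, rfl⟩
  refine mem_closedBall_zero_iff.2 ?_
  have hx : x = ∑ i, x i • EuclideanSpace.single i (1:ℝ) := by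
    ext j
    simp [Finset.sum_apply, Pi.single_apply]
  have hxz : x + z = ∑ i, (Int.fract (x i / p i) * p i) • EuclideanSpace.single i (1:ℝ) := by
    conv_lhs => rw [hx]
    simp only [z]
    rw [← Finset.sum_add_distrib]
    refine Finset.sum_congr rfl fun i _ => ?_
    rw [← Int.cast_smul_eq_zsmul ℝ, smul_smul, ← add_smul]
    congr 1
    have := (hp i).ne'
    rw [Int.fract]
    push_cast
    field_simp
    ring
  rw [hxz]
  refine (norm_sum_le (E := Euc N) _ _).trans (Finset.sum_le_sum fun i _ => ?_)
  rw [norm_smul]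
  simp only [EuclideanSpace.norm_single, norm_one, mul_one]
  rw [Real.norm_of_nonneg (mul_nonneg (Int.fract_nonneg _) (hp i).le)]
  have := (Int.fract_lt_one (x i / p i)).le
  nlinarith [hp i]

lemma ker_int {N : ℕ} {κ : Euc N → ℝ} (hκ : KernelHyp κ) (g : Euc N → ℝ) (hg : Continuous g)
    (x : Euc N) : Integrable (fun y => κ (y - x) * g y) := by
  apply Continuous.integrable_of_hasCompactSupport
  · exact (hκ.1.comp (continuous_id.sub continuous_const)).mul hg
  · apply HasCompactSupport.mul_right
    exact hκ.2.2.1.comp_homeomorph (Homeomorph.subRight x)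

lemma comp_lem {N : ℕ} {κ : Euc N → ℝ} (hκ : KernelHyp κ) (w b w' : ℝ → Euc N → ℝ)
    (t₁ C F : ℝ) (hF : 0 ≤ F) (hC : 0 ≤ C)
    (hc : ∀ t ∈ Icc 0 t₁, Continuous (w t))
    (hct : ∀ x, ContinuousOn (fun t => w t x) (Icc 0 t₁))
    (hd : ∀ t ∈ Ioo 0 t₁, ∀ x, HasDerivAt (fun s => w s x) (w' t x) t)
    (hle : ∀ t ∈ Ioo 0 t₁, ∀ x, w' t x ≤ (∫ y, κ (y - x) * w t y) - w t x + b t x * w t x)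
    (hb : ∀ t ∈ Icc 0 t₁, ∀ x, |b t x| ≤ F)
    (h0 : ∀ x, w 0 x ≤ 0)
    (hwC : ∀ t ∈ Icc 0 t₁, ∀ x, w t x ≤ C) :
    ∀ t ∈ Icc 0 t₁, ∀ x, w t x ≤ 0 := by
  have hK1 : ∀ x, ∫ y, κ (y - x) = 1 := fun x => by
    rw [integral_sub_right_eq_self κ x]; exact hκ.2.2.2.2
  set B := F + 1 with hBdef
  set L := 1 + 2 * B with hL
  set C' := Real.exp (B * t₁) * C with hC'
  have key : ∀ n : ℕ, ∀ t ∈ Icc 0 t₁, ∀ x,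
      Real.exp (B * t) * w t x ≤ C' * (L ^ n * t ^ n / n.factorial) := by
    intro n
    induction n with
    | zero =>
      intro t ht x
      simp only [pow_zero, Nat.factorial_zero, Nat.cast_one, mul_one, div_one]
      have h1 : Real.exp (B * t) ≤ Real.exp (B * t₁) := by
        apply Real.exp_le_exp.2
        exact mul_le_mul_of_nonneg_left ht.2 (by positivity)
      calc Real.exp (B * t) * w t x ≤ Real.exp (B * t) * C :=
            mul_le_mul_of_nonneg_left (hwC t ht x) (Real.exp_pos _).le
        _ ≤ _ := mul_le_mul_of_nonneg_right h1 hC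
    | succ n ih =>
      intro t ht x
      let G : ℝ → ℝ := fun s => Real.exp (B * s) * w s x
        - C' * (L ^ (n+1) * s ^ (n+1) / (n+1).factorial)
      let G' : ℝ → ℝ := fun s => (Real.exp (B * s) * B * w s x + Real.exp (B * s) * w' s x)
        - C' * L * (L ^ n * s ^ n / n.factorial)
      have hG : ∀ s ∈ Ioo 0 t₁, HasDerivAt G (G' s) s := by
        intro s hs
        have e1 : HasDerivAt (fun s => Real.exp (B * s)) (Real.exp (B * s) * B) s := by
          simpa using ((hasDerivAt_id s).const_mul B).exp
        have e2 := e1.mul (hd s hs x)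
        have e3 : HasDerivAt (fun s : ℝ => C' * (L ^ (n+1) * s ^ (n+1) / (n+1).factorial))
            (C' * L * (L ^ n * s ^ n / n.factorial)) s := by
          have := ((((hasDerivAt_pow (n+1) s).const_mul (L ^ (n+1))).div_const
            ((n+1).factorial : ℝ)).const_mul C')
          refine this.congr_deriv ?_
          rw [Nat.factorial_succ]
          have : (n.factorial : ℝ) ≠ 0 := by positivity
          have h2 : ((n : ℝ) + 1) ≠ 0 := by positivity
          push_cast
          field_simp
          ring
        exact e2.sub e3
      have hG' : ∀ s ∈ Ioo 0 t₁, G' s ≤ 0 := by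
        intro s hs
        have hs' : s ∈ Icc 0 t₁ := ⟨hs.1.le, hs.2.le⟩
        set m := C' * (L ^ n * s ^ n / n.factorial) with hm
        have hm0 : 0 ≤ m := by
          have := hs.1.le
          positivity
        have hE := Real.exp_pos (B * s)
        set E := Real.exp (B * s) with hEd
        have hint : E * ∫ y, κ (y - x) * w s y ≤ m := by
          rw [← integral_const_mul]
          calc ∫ y, E * (κ (y - x) * w s y) ≤ ∫ y, κ (y - x) * m := by
                apply integral_mono
                · exact (ker_int hκ _ (hc s hs') x).const_mul E
                · exact ker_int hκ (fun _ => m) continuous_const x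
                · intro y
                  have := mul_le_mul_of_nonneg_left (ih s hs' y) (hκ.2.1 (y - x))
                  simp only
                  linarith
            _ = m := by rw [integral_mul_const, hK1, one_mul]
        have hw := hle s hs x
        have hbb := abs_le.1 (hb s hs' x)
        have hcoef : (b s x - 1 + B) * (E * w s x) ≤ (b s x - 1 + B) * m :=
          mul_le_mul_of_nonneg_left (ih s hs' x) (by linarith [hbb.1])
        have hcoef2 : (b s x - 1 + B) * m ≤ (2 * B) * m :=
          mul_le_mul_of_nonneg_right (by linarith [hbb.2]) hm0
        have h3 := mul_le_mul_of_nonneg_left hw hE.le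
        have : G' s = E * B * w s x + E * w' s x - L * m := by
          simp only [G', hm, hEd]; ring
        rw [this, hL]
        nlinarith
      have hanti : AntitoneOn G (Icc 0 t₁) := by
        apply antitoneOn_of_deriv_nonpos (convex_Icc _ _)
        · apply ContinuousOn.sub
          · exact ContinuousOn.mul (by fun_prop) (hct x)
          · fun_prop
        · intro s hs
          rw [interior_Icc] at hs
          exact (hG s hs).differentiableAt.differentiableWithinAt
        · intro s hs
          rw [interior_Icc] at hs
          rw [(hG s hs).deriv]
          exact hG' s hs
      have h1 := hanti (left_mem_Icc.2 (ht.1.trans ht.2)) ht ht.1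
      have h2 : G 0 ≤ 0 := by
        simp only [G]
        simpa using h0 x
      have h3 : G t ≤ 0 := h1.trans h2
      simp only [G] at h3
      linarith
  intro t ht x
  have hlim : Tendsto (fun n : ℕ => C' * (L ^ n * t ^ n / n.factorial)) atTop (nhds 0) := by
    have := (FloorSemiring.tendsto_pow_div_factorial_atTop (L * t)).const_mul C'
    simpa [mul_pow] using this
  have h := ge_of_tendsto' hlim (fun n => key n t ht x)
  by_contra hn
  push Not at hn
  exact absurd h (not_le.2 (mul_pos (Real.exp_pos _) hn))

/-- exponential super-solution bound and upper spreading estimate. -/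
theorem stmt14 {N : ℕ} (hN : 1 ≤ N) (T M₀ : ℝ) (hT : 0 < T) (hM₀ : 0 < M₀)
    (κ : Euc N → ℝ) (hκ : KernelHyp κ)
    (f : ℝ → Euc N → ℝ → ℝ) (hf : SatH0 T M₀ f)
    (p : Fin N → ℝ) (hp : ∀ i, 0 < p i)
    (ξ : Euc N) (hξ : ‖ξ‖ = 1) (μ : ℝ) (hμ : 0 < μ) (lam : ℝ)
    (a φ : ℝ → Euc N → ℝ)
    (hac : Continuous (fun q : ℝ × Euc N => a q.1 q.2))
    (hφc : Continuous (fun q : ℝ × Euc N => φ q.1 q.2))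
    (haper : ∀ t x, a (t + T) x = a t x)
    (haspace : ∀ i t x, a t (x + p i • EuclideanSpace.single i (1:ℝ)) = a t x)
    (hφper : ∀ t x, φ (t + T) x = φ t x)
    (hφspace : ∀ i t x, φ t (x + p i • EuclideanSpace.single i (1:ℝ)) = φ t x)
    (hφpos : ∃ δ > 0, ∀ t x, δ ≤ φ t x)
    (hφeq : ∀ t x, HasDerivAt (fun s => φ s x)
      ((∫ y, Real.exp (-μ * ⟪y - x, ξ⟫) * κ (y - x) * φ t y) - φ t x
        + a t x * φ t x - lam * φ t x) t)
    (hfa : ∀ t x u, 0 ≤ u → f t x u ≤ a t x)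
    (M : ℝ) (hMpos : 0 < M)
    (u : ℝ → Euc N → ℝ) (hu : IsSol κ f u (Set.Ici 0))
    (hinit : ∀ x, 0 ≤ u 0 x ∧ u 0 x ≤ M * Real.exp (-μ * ⟪x, ξ⟫) * φ 0 x)
    (hupos : ∀ t ≥ (0:ℝ), ∀ x, 0 ≤ u t x) :
    (∀ t ≥ (0:ℝ), ∀ x, u t x ≤ M * Real.exp (-μ * (⟪x, ξ⟫ - (lam / μ) * t)) * φ t x) ∧
    (∀ c > lam / μ, ∀ ε > (0:ℝ), ∃ t₀ : ℝ, ∀ t ≥ t₀, ∀ x,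
      c * t ≤ ⟪x, ξ⟫ → u t x ≤ ε) := by
  have main : ∀ t ≥ (0:ℝ), ∀ x,
      u t x ≤ M * Real.exp (-μ * (⟪x, ξ⟫ - (lam / μ) * t)) * φ t x := by
    intro t₁ ht₁ x₁
    obtain ⟨δ, hδ, hφδ⟩ := hφpos
    obtain ⟨huc, huX, hub, hud⟩ := hu
    obtain ⟨C, hC⟩ := hub (Icc 0 t₁) (fun s hs => hs.1) isCompact_Icc
    obtain ⟨F, hF⟩ := (hf.2.2.1 (|C| + 1) (by positivity)).1
    have hFb : ∀ t ∈ Icc 0 t₁, ∀ x, |f t x (u t x)| ≤ F := by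
      intro t ht x
      have h1 := hF t x (u t x) (by linarith [hC t ht x, le_abs_self C])
      linarith [abs_nonneg (deriv (fun s => f s x (u t x)) t),
        abs_nonneg (deriv (fun v => f t x v) (u t x))]
    have hC0 : 0 ≤ C := (abs_nonneg _).trans (hC 0 (left_mem_Icc.2 ht₁) 0)
    have hF0 : 0 ≤ F := (abs_nonneg _).trans (hFb 0 (left_mem_Icc.2 ht₁) 0)
    let v : ℝ → Euc N → ℝ := fun t x =>
      M * Real.exp (-μ * (⟪x, ξ⟫ - (lam / μ) * t)) * φ t x
    have hv0 : ∀ t x, 0 ≤ v t x := fun t x => by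
      have := hδ.le.trans (hφδ t x)
      positivity
    have hvc : ∀ t, Continuous (v t) := by
      intro t
      have : Continuous (φ t) := hφc.comp (continuous_const.prodMk continuous_id)
      simp only [v]
      fun_prop
    have hvK : ∀ t x, (∫ y, κ (y - x) * v t y) =
        M * Real.exp (-μ * (⟪x, ξ⟫ - (lam / μ) * t)) *
          ∫ y, Real.exp (-μ * ⟪y - x, ξ⟫) * κ (y - x) * φ t y := by
      intro t x
      rw [← integral_const_mul]
      congr 1
      ext y
      have : Real.exp (-μ * (⟪y, ξ⟫ - (lam / μ) * t)) =
          Real.exp (-μ * (⟪x, ξ⟫ - (lam / μ) * t)) * Real.exp (-μ * ⟪y - x, ξ⟫) := by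
        rw [← Real.exp_add, inner_sub_left]
        congr 1
        ring
      simp only [v]
      rw [this]
      ring
    have hvd : ∀ t x, HasDerivAt (fun s => v s x)
        ((∫ y, κ (y - x) * v t y) - v t x + a t x * v t x) t := by
      intro t x
      have e1 : HasDerivAt (fun s : ℝ => M * Real.exp (-μ * (⟪x, ξ⟫ - (lam / μ) * s)))
          (M * (Real.exp (-μ * (⟪x, ξ⟫ - (lam / μ) * t)) * lam)) t := by
        have h := (((((hasDerivAt_id t).const_mul (lam / μ)).const_sub ⟪x, ξ⟫).const_mul
          (-μ)).exp).const_mul M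
        refine h.congr_deriv ?_
        simp only [id]
        field_simp
      have e2 := e1.mul (hφeq t x)
      refine HasDerivAt.congr_deriv e2 ?_
      rw [hvK]
      simp only [v]
      ring
    have := comp_lem hκ (fun t x => u t x - v t x) (fun t x => f t x (u t x))
      (fun t x => RHS κ f u t x - ((∫ y, κ (y - x) * v t y) - v t x + a t x * v t x))
      t₁ C F hF0 hC0
      (fun t ht => (huX t ht.1).1.continuous.sub (hvc t))
      (fun x => by
        apply ContinuousOn.sub
        · exact huc.comp (f := fun t : ℝ => (t, x)) (by fun_prop)
            (fun t ht => ⟨ht.1, mem_univ _⟩)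
        · exact fun t _ => (hvd t x).continuousAt.continuousWithinAt)
      (fun t ht x => (hud x t (by rw [interior_Ici]; exact ht.1)).sub (hvd t x))
      (fun t ht x => by
        have h1 : (∫ y, κ (y - x) * (u t y - v t y)) =
            (∫ y, κ (y - x) * u t y) - ∫ y, κ (y - x) * v t y := by
          rw [← integral_sub (ker_int hκ _ (huX t ht.1.le).1.continuous x)
            (ker_int hκ _ (hvc t) x)]
          congr 1
          ext y
          ring
        simp only [RHS]
        rw [h1]
        have h2 := mul_le_mul_of_nonneg_right
          (hfa t x (u t x) (hupos t ht.1.le x)) (hv0 t x)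
        linarith)
      hFb
      (fun x => by
        have := (hinit x).2
        simp only [v, mul_zero, sub_zero]
        linarith)
      (fun t ht x => by
        have := (le_abs_self _).trans (hC t ht x)
        have := hv0 t x
        linarith)
      t₁ (right_mem_Icc.2 ht₁) x₁
    simp only [v] at this
    linarith
  refine ⟨main, ?_⟩
  intro c hc ε hε
  obtain ⟨B, hB0, hB⟩ := per_bound T hT p hp φ hφc hφper hφspace
  have hlim : Tendsto (fun t : ℝ => M * Real.exp (-(μ * (c - lam / μ) * t)) * B) atTop
      (nhds 0) := by
    have hk : 0 < μ * (c - lam / μ) := mul_pos hμ (sub_pos.2 hc)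
    have h1 := Real.tendsto_exp_neg_atTop_nhds_zero.comp (tendsto_id.const_mul_atTop hk)
    simpa using (h1.const_mul M).mul_const B
  obtain ⟨t₀, ht₀⟩ := eventually_atTop.1 (hlim.eventually (ge_mem_nhds hε))
  refine ⟨max t₀ 0, fun t ht x hx => ?_⟩
  refine ((main t ((le_max_right _ _).trans ht) x).trans ?_).trans
    (ht₀ t ((le_max_left _ _).trans ht))
  have h1 : Real.exp (-μ * (⟪x, ξ⟫ - (lam / μ) * t)) ≤
      Real.exp (-(μ * (c - lam / μ) * t)) := by
    apply Real.exp_le_exp.2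
    nlinarith
  have h2 : M * Real.exp (-μ * (⟪x, ξ⟫ - (lam / μ) * t)) ≤
      M * Real.exp (-(μ * (c - lam / μ) * t)) := mul_le_mul_of_nonneg_left h1 hMpos.le
  exact (mul_le_mul_of_nonneg_left (hB t x) (by positivity)).trans
    (mul_le_mul_of_nonneg_right h2 hB0)

end
end

section
/- Persistence at sublinear spreading speed implies locally uniform convergence to the periodic solution, directional version (Lemma 5.1(1), nonlocal dispersal case). Assume f satisfies (H0), (H1) holds with limit nonlinearity f₀, (E_f) has a time periodic strictly positive solution u*, and (E_{f₀}) has a solution u₀* on ℝ with u₀*(t+T,x) = u₀*(t,x) = u₀*(t, x+pᵢeᵢ) for all t, x, i and u₀*(t,x) > 0 everywhere. Let ξ ∈ ℝ^N be a unit vector, c > 0, and let u be a solution of (E_f) on [0,∞) with u(0,x) ≥ 0 for all x. If there exist δ > 0 and T* > 0 such that u(t,x) ≥ δ whenever t ≥ T* and x·ξ ≤ ct, then for every 0 < c' < c, sup{ |u(t,x) − u*(t,x)| : x·ξ ≤ c't } → 0 as t → ∞. -/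
open MeasureTheory Set Filter RealInnerProductSpace

noncomputable section

lemma mp_half {α : Type*} (lam S t0 t1 : ℝ) (y : ℝ → α → ℝ) (hS : 0 ≤ S)
    (hcont : ∀ x, ContinuousOn (fun t => y t x) (Icc t0 t1))
    (h0 : ∀ x, y t0 x ≤ 0)
    (hb : ∀ t ∈ Icc t0 t1, ∀ x, y t x ≤ S)
    (hd : ∀ x, ∀ t ∈ Ioo t0 t1, 0 < y t x → ∃ d, HasDerivAt (fun s => y s x) d t ∧
      ∀ m, 0 ≤ m → (∀ x', y t x' ≤ m) → d ≤ lam * m - 2 * lam * y t x) (hlam : 0 ≤ lam) :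
    ∀ t ∈ Icc t0 t1, ∀ x, y t x ≤ S / 2 := by
  intro t ht x
  by_contra hcon
  push Not at hcon
  -- last time below S/2
  let A : Set ℝ := {s ∈ Icc t0 t | y s x ≤ S / 2}
  have hsub : Icc t0 t ⊆ Icc t0 t1 := Icc_subset_Icc le_rfl ht.2
  have hAc : IsCompact A := by
    have : IsClosed A := by
      have := ((hcont x).mono hsub).preimage_isClosed_of_isClosed isClosed_Icc
        (isClosed_Iic (a := S / 2))
      exact this
    exact isCompact_Icc.of_isClosed_subset this (fun s hs => hs.1)
  have hAn : A.Nonempty := ⟨t0, ⟨le_rfl, ht.1⟩, (h0 x).trans (by positivity)⟩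
  obtain ⟨s, hsA, hsmax⟩ := hAc.exists_isGreatest hAn
  have hst : s < t := by
    rcases lt_or_eq_of_le hsA.1.2 with h | h
    · exact h
    · exfalso
      have := hsA.2
      rw [h] at this
      linarith
  have hpos : ∀ r ∈ Ioo s t, S / 2 < y r x := by
    intro r hr
    by_contra hh
    push Not at hh
    have := hsmax (show r ∈ A from ⟨⟨hsA.1.1.trans hr.1.le, hr.2.le⟩, hh⟩)
    exact absurd hr.1 (not_lt.mpr this)
  have hder : ∀ r ∈ Ioo s t, ∃ d, HasDerivAt (fun s => y s x) d r ∧ d ≤ 0 := by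
    intro r hr
    have hr' : r ∈ Ioo t0 t1 := ⟨lt_of_le_of_lt hsA.1.1 hr.1, lt_of_lt_of_le hr.2 ht.2⟩
    have hp := hpos r hr
    obtain ⟨d, hd1, hd2⟩ := hd x r hr' (by linarith)
    refine ⟨d, hd1, ?_⟩
    have := hd2 S hS (hb r ⟨hr'.1.le, hr'.2.le⟩)
    nlinarith
  have hcon2 : ContinuousOn (fun t => y t x) (Icc s t) :=
    (hcont x).mono (Icc_subset_Icc hsA.1.1 ht.2)
  obtain ⟨r, hr, hrr⟩ := exists_deriv_eq_slope (fun s => y s x) hst hcon2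
    (fun r hr => (hder r hr).choose_spec.1.differentiableAt.differentiableWithinAt)
  obtain ⟨d, hd1, hd2⟩ := hder r hr
  rw [hd1.deriv] at hrr
  have h3 := hsA.2
  have : 0 < (y t x - y s x) / (t - s) := div_pos (by linarith) (by linarith)
  linarith

lemma mp {α : Type*} (C B t0 t1 : ℝ) (z : ℝ → α → ℝ) (hC : 0 ≤ C)
    (hcont : ∀ x, ContinuousOn (fun t => z t x) (Icc t0 t1))
    (h0 : ∀ x, z t0 x ≤ 0)
    (hb : ∀ t ∈ Icc t0 t1, ∀ x, z t x ≤ B)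
    (hd : ∀ x, ∀ t ∈ Ioo t0 t1, 0 < z t x → ∃ d, HasDerivAt (fun s => z s x) d t ∧
      ∀ m, 0 ≤ m → (∀ x', z t x' ≤ m) → d ≤ C * m) :
    ∀ t ∈ Icc t0 t1, ∀ x, z t x ≤ 0 := by
  let y : ℝ → α → ℝ := fun t x => z t x * Real.exp (-(2 * C) * (t - t0))
  have key : ∀ n : ℕ, ∀ t ∈ Icc t0 t1, ∀ x, y t x ≤ |B| / 2 ^ n := by
    intro n
    induction n with
    | zero =>
      intro t ht x
      have h1 : Real.exp (-(2 * C) * (t - t0)) ≤ 1 := by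
        rw [Real.exp_le_one_iff]
        nlinarith [ht.1]
      have h2 := Real.exp_pos (-(2 * C) * (t - t0))
      have h3 : z t x ≤ |B| := (hb t ht x).trans (le_abs_self B)
      simp only [pow_zero, div_one, y]
      nlinarith [abs_nonneg B]
    | succ n ih =>
      have := mp_half C (|B| / 2 ^ n) t0 t1 y (by positivity) ?_ ?_ ih ?_ hC
      · intro t ht x
        have := this t ht x
        rw [pow_succ, ← div_div]
        exact this
      · intro x
        exact (hcont x).mul (by fun_prop)
      · intro x
        simpa [y] using h0 x
      · intro x t ht hy
        have he := Real.exp_pos (-(2 * C) * (t - t0))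
        have hz : 0 < z t x := by
          by_contra hh
          push Not at hh
          have : y t x ≤ 0 := mul_nonpos_of_nonpos_of_nonneg hh he.le
          linarith
        obtain ⟨d, hd1, hd2⟩ := hd x t ht hz
        have hE : HasDerivAt (fun s => Real.exp (-(2 * C) * (s - t0)))
            (Real.exp (-(2 * C) * (t - t0)) * (-(2 * C) * 1)) t :=
          (((hasDerivAt_id t).sub_const t0).const_mul (-(2 * C))).exp
        refine ⟨_, hd1.mul hE, ?_⟩
        intro m hm hym
        have h4 := hd2 (m / Real.exp (-(2 * C) * (t - t0))) (by positivity) (by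
          intro x'
          rw [le_div_iff₀ he]
          exact hym x')
        have h5 : d * Real.exp (-(2 * C) * (t - t0)) ≤ C * m := by
          calc d * Real.exp (-(2 * C) * (t - t0)) ≤
              (C * (m / Real.exp (-(2 * C) * (t - t0)))) * Real.exp (-(2 * C) * (t - t0)) :=
                mul_le_mul_of_nonneg_right h4 he.le
            _ = C * m := by field_simp
        simp only [y]
        nlinarith
  intro t ht x
  have hlim : Tendsto (fun n : ℕ => |B| / 2 ^ n) atTop (nhds 0) := by
    have := (tendsto_pow_atTop_nhds_zero_of_lt_one (r := (1/2:ℝ)) (by norm_num)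
      (by norm_num)).const_mul |B|
    simpa [div_eq_mul_inv] using this
  have hy : y t x ≤ 0 := ge_of_tendsto' hlim (fun n => key n t ht x)
  have he := Real.exp_pos (-(2 * C) * (t - t0))
  by_contra hh
  push Not at hh
  have : 0 < y t x := mul_pos hh he
  linarith

lemma ker_le {N : ℕ} {κ : Euc N → ℝ} (hκ : KernelHyp κ) (g : Euc N → ℝ) (hg : Continuous g)
    (x : Euc N) (m : ℝ) (h : ∀ y, κ (y - x) ≠ 0 → g y ≤ m) :
    ∫ y, κ (y - x) * g y ≤ m := by
  have h1 : ∫ y, κ (y - x) * m = m := by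
    rw [integral_mul_const, integral_sub_right_eq_self (fun y => κ y) x, hκ.2.2.2.2, one_mul]
  rw [← h1]
  refine integral_mono (ker_int hκ g hg x) (ker_int hκ (fun _ => m) continuous_const x) ?_
  intro y
  by_cases hy : κ (y - x) = 0
  · simp [hy]
  · exact mul_le_mul_of_nonneg_left (h y hy) (hκ.2.1 _)

lemma f_decr {N : ℕ} {T M₀ : ℝ} {f : ℝ → Euc N → ℝ → ℝ} (hf : SatH0 T M₀ f) (b : ℝ)
    (hb : 0 ≤ b) : ∃ c0 > 0, ∀ t x v w, 0 ≤ v → v ≤ w → w ≤ b →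
      f t x w - f t x v ≤ - c0 * (w - v) := by
  obtain ⟨c, hc, h⟩ := hf.2.2.2.2 0 b le_rfl hb
  refine ⟨-c, by linarith, ?_⟩
  intro t x v w hv hvw hwb
  have hdiff : Differentiable ℝ (fun v => f t x v) := by
    have := (hf.2.1 x).differentiable (by norm_num)
    exact this.comp (f := fun v : ℝ => ((t, v) : ℝ × ℝ)) (by fun_prop)
  have := (convex_Icc (0:ℝ) b).image_sub_le_mul_sub_of_deriv_le hdiff.continuous.continuousOn
    hdiff.differentiableOn (C := c) (by
      intro u hu
      have hu' := interior_subset hu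
      exact h t x u hu'.1 hu'.2) v ⟨hv, hvw.trans hwb⟩ w ⟨hv.trans hvw, hwb⟩ hvw
  linarith

lemma f_anti {N : ℕ} {T M₀ : ℝ} {f : ℝ → Euc N → ℝ → ℝ} (hf : SatH0 T M₀ f) (t : ℝ) (x : Euc N)
    (v w : ℝ) (hv : 0 ≤ v) (hvw : v ≤ w) : f t x w ≤ f t x v := by
  obtain ⟨c0, hc0, h⟩ := f_decr hf w (hv.trans hvw)
  have := h t x v w hv hvw le_rfl
  nlinarith

lemma f_bdd {N : ℕ} {T M₀ : ℝ} {f : ℝ → Euc N → ℝ → ℝ} (hf : SatH0 T M₀ f) (R : ℝ) :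
    ∃ C ≥ 0, ∀ t x u, |u| ≤ R → |f t x u| ≤ C := by
  obtain ⟨C, hC⟩ := (hf.2.2.1 (max R 1) (by positivity)).1
  refine ⟨|C|, abs_nonneg _, ?_⟩
  intro t x u hu
  have := hC t x u (hu.trans (le_max_left _ _))
  have h2 := abs_nonneg (deriv (fun s => f s x u) t)
  have h3 := abs_nonneg (deriv (fun v => f t x v) u)
  have := le_abs_self C
  linarith

lemma sol_cont {N : ℕ} {κ : Euc N → ℝ} {g : ℝ → Euc N → ℝ → ℝ} {u : ℝ → Euc N → ℝ} {I : Set ℝ}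
    (hu : IsSol κ g u I) (x : Euc N) : ContinuousOn (fun t => u t x) I := by
  exact hu.1.comp (f := fun t : ℝ => ((t, x) : ℝ × Euc N)) (by fun_prop)
    (fun t ht => ⟨ht, mem_univ _⟩)

lemma per_bdd {N : ℕ} {κ : Euc N → ℝ} {g : ℝ → Euc N → ℝ → ℝ} {T : ℝ} (hT : 0 < T)
    {u : ℝ → Euc N → ℝ} (hu : PeriodicPosSol κ g T u) : ∃ U > 0, ∀ t x, u t x ≤ U := by
  obtain ⟨C, hC⟩ := hu.1.2.2.1 (Icc 0 T) (subset_univ _) isCompact_Icc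
  refine ⟨|C| + 1, by positivity, ?_⟩
  intro t x
  have hp : Function.Periodic (fun t => u t x) T := fun t => hu.2.1 t x
  obtain ⟨s, hs, hst⟩ := hp.exists_mem_Ico₀ hT t
  have h := hC s ⟨hs.1, hs.2.le⟩ x
  have h2 : u t x = u s x := hst
  rw [h2]
  linarith [le_abs_self (u s x), le_abs_self C]

lemma sol_nonneg {N : ℕ} {T M₀ : ℝ} {κ : Euc N → ℝ} (hκ : KernelHyp κ)
    {f : ℝ → Euc N → ℝ → ℝ} (hf : SatH0 T M₀ f) {u : ℝ → Euc N → ℝ}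
    (hu : IsSol κ f u (Set.Ici 0)) (hu0 : ∀ x, 0 ≤ u 0 x) :
    ∀ t, 0 ≤ t → ∀ x, 0 ≤ u t x := by
  intro t1 ht1 x1
  obtain ⟨R, hR⟩ := hu.2.2.1 (Icc 0 t1) (fun s hs => hs.1) isCompact_Icc
  obtain ⟨C, hC0, hC⟩ := f_bdd hf R
  have := mp (1 + C) R 0 t1 (fun t x => - u t x) (by linarith)
    (fun x => ((sol_cont hu x).mono (fun s hs => hs.1)).neg)
    (fun x => by simpa using hu0 x)
    (fun t ht x => (neg_le_abs _).trans (hR t ht x)) ?_ t1 ⟨ht1, le_rfl⟩ x1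
  · simpa using this
  · intro x t ht hz
    refine ⟨_, (hu.2.2.2 x t (by rw [interior_Ici]; exact ht.1)).neg, ?_⟩
    intro m hm hle
    have hcu : Continuous (u t) := (hu.2.1 t ht.1.le).1.continuous
    have h1 := ker_le hκ (fun y => - u t y) hcu.neg x m (fun y _ => hle y)
    have h2 : ∫ y, κ (y - x) * (- u t y) = - ∫ y, κ (y - x) * u t y := by
      rw [← integral_neg]; congr 1; ext y; ring
    have h3 := hC t x (u t x) (hR t ⟨ht.1.le, ht.2.le⟩ x)
    have h4 := abs_le.mp h3
    have h5 := hle x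
    simp only [RHS]
    rw [h2] at h1
    nlinarith

lemma sol_upper {N : ℕ} {T M₀ : ℝ} (hT : 0 < T) {κ : Euc N → ℝ} (hκ : KernelHyp κ)
    {f : ℝ → Euc N → ℝ → ℝ} (hf : SatH0 T M₀ f) {u : ℝ → Euc N → ℝ}
    (hu : IsSol κ f u (Set.Ici 0))
    {v : ℝ → Euc N → ℝ} (hv : PeriodicPosSol κ f T v) :
    ∃ A > 0, ∃ β > 0, ∀ t, 0 ≤ t → ∀ x, u t x ≤ v t x * (1 + A * Real.exp (-β * t)) := by
  obtain ⟨U, hU, hvU⟩ := per_bdd hT hv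
  obtain ⟨hvs, hvp, η, hη, hvη⟩ := hv
  obtain ⟨C0, hC0⟩ := (hu.2.1 0 (by simp)).2
  obtain ⟨A, hA, hAC⟩ : ∃ A > 0, C0 ≤ η * A := by
    refine ⟨|C0| / η + 1, by positivity, ?_⟩
    have : η * (|C0| / η + 1) = |C0| + η := by field_simp
    rw [this]
    linarith [le_abs_self C0]
  obtain ⟨c0, hc0, hdec⟩ := f_decr hf (U * (1 + A)) (by positivity)
  refine ⟨A, hA, c0 * η, by positivity, ?_⟩
  intro t1 ht1 x1
  obtain ⟨R, hR⟩ := hu.2.2.1 (Icc 0 t1) (fun s hs => hs.1) isCompact_Icc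
  obtain ⟨C, hCn, hC⟩ := f_bdd hf U
  have hvpos : ∀ t x, 0 < v t x := fun t x => lt_of_lt_of_le hη (hvη t x)
  have := mp (1 + C) R 0 t1
    (fun t x => u t x - v t x * (1 + A * Real.exp (-(c0 * η) * t))) (by linarith)
    (fun x => ((sol_cont hu x).mono (fun s hs => hs.1)).sub
      (((sol_cont hvs x).mono (subset_univ _)).mul (by fun_prop)))
    (fun x => ?_) (fun t ht x => ?_) ?_ t1 ⟨ht1, le_rfl⟩ x1
  · linarith
  · have h1 := (abs_le.mp (hC0 x)).2
    have h2 := hvη 0 x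
    simp only [mul_zero, Real.exp_zero, mul_one]
    nlinarith
  · have h1 := (abs_le.mp (hR t ht x)).2
    have h2 := hvpos t x
    have h3 := Real.exp_pos (-(c0 * η) * t)
    have : 0 < v t x * (1 + A * Real.exp (-(c0 * η) * t)) := by positivity
    linarith
  · intro x t ht hz
    have hE : HasDerivAt (fun s => 1 + A * Real.exp (-(c0 * η) * s))
        (A * (Real.exp (-(c0 * η) * t) * (-(c0 * η) * 1))) t :=
      ((((hasDerivAt_id t).const_mul (-(c0 * η))).exp).const_mul A).const_add 1
    refine ⟨_, (hu.2.2.2 x t (by rw [interior_Ici]; exact ht.1)).sub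
      ((hvs.2.2.2 x t (by simp)).mul hE), ?_⟩
    intro m hm hle
    have he := Real.exp_pos (-(c0 * η) * t)
    have he1 : Real.exp (-(c0 * η) * t) ≤ 1 := by
      rw [Real.exp_le_one_iff]
      have : 0 < (c0 * η) * t := mul_pos (by positivity) ht.1
      linarith
    set E := Real.exp (-(c0 * η) * t) with hEdef
    have hcu : Continuous (u t) := (hu.2.1 t ht.1.le).1.continuous
    have hcv : Continuous (v t) := (hvs.2.1 t (mem_univ _)).1.continuous
    have h1 := ker_le hκ (fun y => u t y - v t y * (1 + A * E)) (by fun_prop) x m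
      (fun y _ => hle y)
    have h2 : ∫ y, κ (y - x) * (u t y - v t y * (1 + A * E)) =
        (∫ y, κ (y - x) * u t y) - (∫ y, κ (y - x) * v t y) * (1 + A * E) := by
      rw [← integral_mul_const, ← integral_sub (ker_int hκ _ hcu x)
        ((ker_int hκ _ hcv x).mul_const _)]
      congr 1; ext y; ring
    rw [h2] at h1
    have hvx := hvpos t x
    have hvU' := hvU t x
    have h3 := (abs_le.mp (hC t x (v t x) (by rw [abs_of_pos hvx]; exact hvU'))).2
    have h5 := hle x
    simp only [RHS]
    have hAE : 0 < A * E := by positivity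
    have hAE1 : A * E ≤ A := by nlinarith
    generalize hW : A * E = q at *
    have hanti := f_anti hf t x (v t x * (1 + q)) (u t x) (by positivity) (by linarith)
    have hd := hdec t x (v t x) (v t x * (1 + q)) hvx.le (by nlinarith)
      (mul_le_mul hvU' (by linarith) (by linarith) hU.le)
    have hηv := hvη t x
    set vv := v t x
    set uu := u t x
    set fv := f t x vv
    set fu := f t x uu
    have e1 : fu - fv ≤ - (c0 * (vv * q)) := by nlinarith
    have hcq : 0 < c0 * (vv * q) := by positivity
    have hvu : vv ≤ uu := by nlinarith
    have e2 : uu * (fu - fv) ≤ vv * (- (c0 * (vv * q))) := by nlinarith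
    have e3 : c0 * η * (vv * q) ≤ vv * (c0 * (vv * q)) := by nlinarith
    have e4 : (uu - vv * (1 + q)) * fv ≤ C * m := by
      have : (uu - vv * (1 + q)) * fv ≤ (uu - vv * (1 + q)) * C :=
        mul_le_mul_of_nonneg_left h3 hz.le
      nlinarith
    have e5 : A * (E * (-(c0 * η) * 1)) = - (c0 * η) * q := by rw [← hW]; ring
    rw [e5]
    nlinarith

lemma exists_mu (U η k c r : ℝ) (hη : 0 < η) (hk : 0 < k) :
    ∃ μ > 0, U * (Real.exp (μ * r) - 1) ≤ η * (k - μ * c) := by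
  have h : Tendsto (fun μ : ℝ => η * (k - μ * c) - U * (Real.exp (μ * r) - 1)) (nhds 0)
      (nhds (η * (k - 0 * c) - U * (Real.exp (0 * r) - 1))) := by
    apply Continuous.tendsto
    fun_prop
  have h' := (h.mono_left (nhdsWithin_le_nhds (s := Ioi 0))).eventually
    (lt_mem_nhds (a := 0) (by simp; positivity))
  obtain ⟨μ, h1, h2⟩ := (h'.and self_mem_nhdsWithin).exists
  exact ⟨μ, h2, by linarith⟩

lemma sol_lower {N : ℕ} {T M₀ : ℝ} (hT : 0 < T) {κ : Euc N → ℝ} (hκ : KernelHyp κ)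
    {f : ℝ → Euc N → ℝ → ℝ} (hf : SatH0 T M₀ f) {u : ℝ → Euc N → ℝ}
    (hu : IsSol κ f u (Set.Ici 0)) (hun : ∀ t, 0 ≤ t → ∀ x, 0 ≤ u t x)
    {v : ℝ → Euc N → ℝ} (hv : PeriodicPosSol κ f T v)
    (ξ : Euc N) (hξ : ‖ξ‖ = 1) (c : ℝ)
    (δ Ts : ℝ) (hδ : 0 < δ) (hTs : 0 < Ts)
    (hpers : ∀ t ≥ Ts, ∀ x : Euc N, ⟪x, ξ⟫ ≤ c * t → δ ≤ u t x) :
    ∃ k > 0, ∃ μ > 0, ∀ t, Ts ≤ t → ∀ x,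
      v t x * (1 - (Real.exp (-k * (t - Ts)) + Real.exp (μ * (⟪x, ξ⟫ - c * t)))) ≤ u t x := by
  obtain ⟨U, hU, hvU⟩ := per_bdd hT hv
  obtain ⟨hvs, hvp, η, hη, hvη⟩ := hv
  have hvpos : ∀ t x, 0 < v t x := fun t x => lt_of_lt_of_le hη (hvη t x)
  obtain ⟨c0, hc0, hdec⟩ := f_decr hf U hU.le
  obtain ⟨r, hr⟩ : ∃ r, ∀ z, κ z ≠ 0 → ‖z‖ ≤ r := by
    obtain ⟨r, hr⟩ := hκ.2.2.1.isCompact.isBounded.exists_norm_le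
    exact ⟨r, fun z hz => hr z (subset_tsupport _ hz)⟩
  obtain ⟨μ, hμ, hμk⟩ := exists_mu U η (δ * c0) c r hη (by positivity)
  refine ⟨δ * c0, by positivity, μ, hμ, ?_⟩
  intro t1 ht1 x1
  obtain ⟨C, hCn, hC⟩ := f_bdd hf U
  have := mp (1 + C) U Ts t1
    (fun t x => v t x * (1 - (Real.exp (-(δ * c0) * (t - Ts)) +
      Real.exp (μ * (⟪x, ξ⟫ - c * t)))) - u t x) (by linarith)
    (fun x => (((sol_cont hvs x).mono (subset_univ _)).mul (by fun_prop)).sub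
      ((sol_cont hu x).mono (fun s hs => hTs.le.trans hs.1)))
    (fun x => ?_) (fun t ht x => ?_) ?_ t1 ⟨ht1, le_rfl⟩ x1
  · linarith
  · have h1 := hun Ts hTs.le x
    have h2 := hvpos Ts x
    have h3 := Real.exp_pos (μ * (⟪x, ξ⟫ - c * Ts))
    simp only [sub_self, mul_zero, Real.exp_zero]
    nlinarith
  · have h1 := hun t (hTs.le.trans ht.1) x
    have h2 := hvpos t x
    have h3 := Real.exp_pos (μ * (⟪x, ξ⟫ - c * t))
    have h4 := Real.exp_pos (-(δ * c0) * (t - Ts))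
    have h5 := hvU t x
    nlinarith
  · intro x t ht hz
    have ht0 : 0 < t := hTs.trans ht.1
    have hE1 : HasDerivAt (fun s => Real.exp (-(δ * c0) * (s - Ts)))
        (Real.exp (-(δ * c0) * (t - Ts)) * (-(δ * c0) * 1)) t :=
      (((hasDerivAt_id t).sub_const Ts).const_mul (-(δ * c0))).exp
    have hE2 : HasDerivAt (fun s => Real.exp (μ * (⟪x, ξ⟫ - c * s)))
        (Real.exp (μ * (⟪x, ξ⟫ - c * t)) * (μ * (-(c * 1)))) t :=
      ((((hasDerivAt_id t).const_mul c).const_sub ⟪x, ξ⟫).const_mul μ).exp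
    refine ⟨_, ((hvs.2.2.2 x t (by simp)).mul ((hE1.add hE2).const_sub 1)).sub
      (hu.2.2.2 x t (by rw [interior_Ici]; exact ht0)), ?_⟩
    intro m hm hle
    have hcu : Continuous (u t) := (hu.2.1 t ht0.le).1.continuous
    have hcv : Continuous (v t) := (hvs.2.1 t (mem_univ _)).1.continuous
    have he1 := Real.exp_pos (-(δ * c0) * (t - Ts))
    have he2 := Real.exp_pos (μ * (⟪x, ξ⟫ - c * t))
    have hux := hun t ht0.le x
    have hvx := hvpos t x
    have hvU' := hvU t x
    have hηv := hvη t x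
    -- shift of the exponential
    have hker2 : ∫ y, κ (y - x) * (v t y * (Real.exp (μ * (⟪y, ξ⟫ - c * t)) -
        Real.exp (μ * (⟪x, ξ⟫ - c * t)))) ≤
        U * (Real.exp (μ * r) - 1) * Real.exp (μ * (⟪x, ξ⟫ - c * t)) := by
      refine ker_le hκ (fun y => v t y * (Real.exp (μ * (⟪y, ξ⟫ - c * t)) -
        Real.exp (μ * (⟪x, ξ⟫ - c * t)))) (by fun_prop) x _ ?_
      intro y hy
      have hn := hr _ hy
      have hr0 : 0 ≤ r := (norm_nonneg _).trans hn
      have hin : ⟪y, ξ⟫ ≤ ⟪x, ξ⟫ + r := by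
        have := real_inner_le_norm (y - x) ξ
        rw [hξ, mul_one, inner_sub_left] at this
        linarith
      have hle1 : Real.exp (μ * (⟪y, ξ⟫ - c * t)) ≤
          Real.exp (μ * r) * Real.exp (μ * (⟪x, ξ⟫ - c * t)) := by
        rw [← Real.exp_add]
        apply Real.exp_le_exp.mpr
        nlinarith
      have hge : 1 ≤ Real.exp (μ * r) := Real.one_le_exp (by positivity)
      calc v t y * (Real.exp (μ * (⟪y, ξ⟫ - c * t)) - Real.exp (μ * (⟪x, ξ⟫ - c * t)))
          ≤ v t y * ((Real.exp (μ * r) - 1) * Real.exp (μ * (⟪x, ξ⟫ - c * t))) :=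
            mul_le_mul_of_nonneg_left (by linarith) (hvpos t y).le
        _ ≤ U * ((Real.exp (μ * r) - 1) * Real.exp (μ * (⟪x, ξ⟫ - c * t))) :=
            mul_le_mul_of_nonneg_right (hvU t y) (mul_nonneg (by linarith) he2.le)
        _ = _ := by ring
    have h1 := ker_le hκ (fun y => v t y * (1 - (Real.exp (-(δ * c0) * (t - Ts)) +
      Real.exp (μ * (⟪y, ξ⟫ - c * t)))) - u t y) (by fun_prop) x m (fun y _ => hle y)
    have h2 : (∫ y, κ (y - x) * (v t y * (1 - (Real.exp (-(δ * c0) * (t - Ts)) +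
        Real.exp (μ * (⟪y, ξ⟫ - c * t)))) - u t y)) +
        ∫ y, κ (y - x) * (v t y * (Real.exp (μ * (⟪y, ξ⟫ - c * t)) -
        Real.exp (μ * (⟪x, ξ⟫ - c * t)))) =
        (∫ y, κ (y - x) * v t y) * (1 - (Real.exp (-(δ * c0) * (t - Ts)) +
        Real.exp (μ * (⟪x, ξ⟫ - c * t)))) - (∫ y, κ (y - x) * u t y) := by
      rw [← integral_mul_const, ← integral_sub ((ker_int hκ _ hcv x).mul_const _)
        (ker_int hκ _ hcu x), ← integral_add (ker_int hκ _ (by fun_prop) x)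
        (ker_int hκ _ (by fun_prop) x)]
      congr 1; ext y; ring
    have h3 := (abs_le.mp (hC t x (v t x) (by rw [abs_of_pos hvx]; exact hvU'))).2
    have h5 := hle x
    have hreg : ⟪x, ξ⟫ ≤ c * t := by
      by_contra hh
      push Not at hh
      have : 1 ≤ Real.exp (μ * (⟪x, ξ⟫ - c * t)) :=
        Real.one_le_exp (mul_nonneg hμ.le (by linarith))
      nlinarith
    have hδu := hpers t ht.1.le x hreg
    simp only [RHS, Pi.add_apply]
    generalize Real.exp (μ * (⟪x, ξ⟫ - c * t)) = q at *
    generalize Real.exp (-(δ * c0) * (t - Ts)) = e at *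
    have huv : u t x ≤ v t x := by nlinarith
    have hd := hdec t x (u t x) (v t x) hux huv hvU'
    set vv := v t x
    set uu := u t x
    set fv := f t x vv
    set fu := f t x uu
    have hcd : vv * (e + q) ≤ vv - uu := by nlinarith
    have e1 : c0 * (vv * (e + q)) ≤ fu - fv := by nlinarith
    have hp : 0 < c0 * (vv * (e + q)) := by positivity
    have e2 : δ * (c0 * (vv * (e + q))) ≤ uu * (fu - fv) := by nlinarith
    have e4 : (vv * (1 - (e + q)) - uu) * fv ≤ C * m := by
      have : (vv * (1 - (e + q)) - uu) * fv ≤ (vv * (1 - (e + q)) - uu) * C :=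
        mul_le_mul_of_nonneg_left h3 hz.le
      nlinarith
    have hkc : U * (Real.exp (μ * r) - 1) * q ≤ vv * (δ * c0 - μ * c) * q := by
      have hr0 : 0 ≤ r := by
        have := hr 0 hκ.2.2.2.1.ne'
        simpa using this
      have hge : 1 ≤ Real.exp (μ * r) := Real.one_le_exp (by positivity)
      have hnn : 0 ≤ U * (Real.exp (μ * r) - 1) := mul_nonneg hU.le (by linarith)
      have : 0 ≤ δ * c0 - μ * c := (mul_nonneg_iff_of_pos_left hη).mp (hnn.trans hμk)
      exact mul_le_mul_of_nonneg_right (hμk.trans (mul_le_mul_of_nonneg_right hηv this)) he2.le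
    linarith

/-- persistence at sublinear spreading speed implies locally uniform
convergence to the periodic solution (directional version). -/
theorem stmt15 {N : ℕ} (hN : 1 ≤ N) (T M₀ : ℝ) (hT : 0 < T) (hM₀ : 0 < M₀)
    (κ : Euc N → ℝ) (hκ : KernelHyp κ)
    (f : ℝ → Euc N → ℝ → ℝ) (hf : SatH0 T M₀ f)
    (f₀ : ℝ → Euc N → ℝ → ℝ) (p : Fin N → ℝ) (h1 : SatH1 T M₀ p f f₀)
    (ustar : ℝ → Euc N → ℝ) (hstar : PeriodicPosSol κ f T ustar)
    (u₀star : ℝ → Euc N → ℝ) (h0star : PeriodicMediaSol κ f₀ T p u₀star)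
    (ξ : Euc N) (hξ : ‖ξ‖ = 1) (c : ℝ) (hc : 0 < c)
    (u : ℝ → Euc N → ℝ) (hu : IsSol κ f u (Set.Ici 0)) (hu0 : ∀ x, 0 ≤ u 0 x)
    (δ Tstar : ℝ) (hδ : 0 < δ) (hTstar : 0 < Tstar)
    (hpers : ∀ t ≥ Tstar, ∀ x : Euc N, ⟪x, ξ⟫ ≤ c * t → δ ≤ u t x) :
    ∀ c' : ℝ, 0 < c' → c' < c → ∀ ε > (0:ℝ), ∃ t₀ : ℝ, ∀ t ≥ t₀, ∀ x : Euc N,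
      ⟪x, ξ⟫ ≤ c' * t → |u t x - ustar t x| ≤ ε := by
  intro c' hc' hcc ε hε
  have hun := sol_nonneg hκ hf hu hu0
  obtain ⟨A, hA, β, hβ, hup⟩ := sol_upper hT hκ hf hu hstar
  obtain ⟨k, hk, μ, hμ, hlo⟩ := sol_lower hT hκ hf hu hun hstar ξ hξ c δ Tstar hδ hTstar hpers
  obtain ⟨U, hU, hvU⟩ := per_bdd hT hstar
  obtain ⟨hvs, hvp, η, hη, hvη⟩ := hstar
  have hlim1 : Tendsto (fun t : ℝ => U * (A * Real.exp (-β * t))) atTop (nhds 0) := by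
    have : Tendsto (fun t : ℝ => Real.exp (-β * t)) atTop (nhds 0) :=
      Real.tendsto_exp_atBot.comp (tendsto_id.const_mul_atTop_of_neg (by linarith))
    simpa using (this.const_mul A).const_mul U
  have hlim2 : Tendsto (fun t : ℝ => U * (Real.exp (-k * (t - Tstar)) +
      Real.exp (-(μ * (c - c')) * t))) atTop (nhds 0) := by
    have h1 : Tendsto (fun t : ℝ => Real.exp (-k * (t - Tstar))) atTop (nhds 0) :=
      Real.tendsto_exp_atBot.comp
        ((tendsto_atTop_add_const_right _ _ tendsto_id).const_mul_atTop_of_neg (by linarith))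
    have h2 : Tendsto (fun t : ℝ => Real.exp (-(μ * (c - c')) * t)) atTop (nhds 0) :=
      Real.tendsto_exp_atBot.comp (tendsto_id.const_mul_atTop_of_neg
        (by have : 0 < μ * (c - c') := mul_pos hμ (by linarith)
            linarith))
    simpa using (h1.add h2).const_mul U
  have hev := (hlim1.eventually (ge_mem_nhds hε)).and ((hlim2.eventually (ge_mem_nhds hε)).and
    (eventually_ge_atTop Tstar))
  obtain ⟨t₀, ht₀⟩ := eventually_atTop.mp hev
  refine ⟨t₀, ?_⟩
  intro t ht x hx
  obtain ⟨h1, h2, h3⟩ := ht₀ t ht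
  have hu1 := hup t (hTstar.le.trans h3) x
  have hl1 := hlo t h3 x
  have hv1 := hvU t x
  have hv2 : 0 < ustar t x := lt_of_lt_of_le hη (hvη t x)
  have hexp : Real.exp (μ * (⟪x, ξ⟫ - c * t)) ≤ Real.exp (-(μ * (c - c')) * t) := by
    apply Real.exp_le_exp.mpr
    nlinarith
  have p1 := Real.exp_pos (-β * t)
  have p2 := Real.exp_pos (-k * (t - Tstar))
  have p3 := Real.exp_pos (μ * (⟪x, ξ⟫ - c * t))
  have q1 : ustar t x * (A * Real.exp (-β * t)) ≤ U * (A * Real.exp (-β * t)) :=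
    mul_le_mul_of_nonneg_right hv1 (by positivity)
  have q2 : ustar t x * (Real.exp (-k * (t - Tstar)) + Real.exp (μ * (⟪x, ξ⟫ - c * t))) ≤
      U * (Real.exp (-k * (t - Tstar)) + Real.exp (-(μ * (c - c')) * t)) :=
    mul_le_mul hv1 (by linarith) (by positivity) hU.le
  rw [abs_le]
  constructor <;> linarith

end
end
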